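/- Let α ∈ T_{(1,1)} with α ∉ {k_1 + k_N, k_1 − k_N, −k_2 − k_3}. Then none of the three vectors 2α − (k_1 + k_N), 2α − (k_1 − k_N), 2α + (k_2 + k_3) lies in Φ. (This is the key step showing that in the T-algebra every basis element other than the three idempotents x_{P1}, x_{P2}, x_{P3} is nilpotent for the product x ∘ y = (1/2)[[x, I⁻], y].) -/

import Mathlib

noncomputable section

open Finset

attribute [local instance] Classical.propDecidable

/-- Standard inner product on ℝ^N. -/
def inn {N : ℕ} (x y : Fin N → ℝ) : ℝ := ∑ i, x i * y i

/-- Standard basis vector k_i (0-indexed). -/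
def kvec {N : ℕ} (i : Fin N) : Fin N → ℝ := fun j => if j = i then 1 else 0

/-- Φ_O : the roots ±k_i ± k_j, i < j (all four sign choices). -/
def PhiO {N : ℕ} : Set (Fin N → ℝ) :=
  {x | ∃ i j : Fin N, i < j ∧ ∃ s t : ℝ, (s = 1 ∨ s = -1) ∧ (t = 1 ∨ t = -1) ∧
    x = s • kvec i + t • kvec j}

/-- Φ_S : the roots (1/2)(ε_1 k_1 + ⋯ + ε_N k_N), each ε_i = ±1, an even number of ε_i = +1. -/
def PhiS {N : ℕ} : Set (Fin N → ℝ) :=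
  {x | ∃ ε : Fin N → ℝ, (∀ i, ε i = 1 ∨ ε i = -1) ∧
    Even ((Finset.univ.filter fun i => ε i = 1).card) ∧
    x = fun i => ε i / 2}

/-- The set of extended roots of e8^(n) (with N = 4(n+1)). -/
def Phi {N : ℕ} : Set (Fin N → ℝ) := PhiO ∪ PhiS

theorem inn_add {N : ℕ} (x y z : Fin N → ℝ) : inn x (y + z) = inn x y + inn x z := by
  simp [inn, mul_add, Finset.sum_add_distrib]

theorem inn_sub {N : ℕ} (x y z : Fin N → ℝ) : inn x (y - z) = inn x y - inn x z := by
  simp [inn, mul_sub, Finset.sum_sub_distrib]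

theorem inn_smul {N : ℕ} (x y : Fin N → ℝ) (c : ℝ) : inn x (c • y) = c * inn x y := by
  simp [inn, Finset.mul_sum, mul_left_comm]

theorem inn_kvec {N : ℕ} (x : Fin N → ℝ) (i : Fin N) : inn x (kvec i) = x i := by
  simp [inn, kvec]

/-- Every coordinate of an extended root has absolute value at most one. -/
theorem abs_le_one_of_mem_Phi {N : ℕ} {x : Fin N → ℝ} (hx : x ∈ Phi) (p : Fin N) :
    |x p| ≤ 1 := by
  rcases hx with ⟨i, j, hij, s, t, hs, ht, rfl⟩ | ⟨ε, hε, -, rfl⟩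
  · have hne := hij.ne
    by_cases hi : p = i
    · have hj : p ≠ j := fun h => hne (hi ▸ h)
      rcases hs with rfl | rfl <;> simp [kvec, hi, hne]
    · by_cases hj : p = j
      · rcases ht with rfl | rfl <;> simp [kvec, hj, hne.symm]
      · simp [kvec, hi, hj]
  · rcases hε p with h | h <;> simp only [h] <;> norm_num [abs_le]

/-- An extended root cannot have three distinct coordinates of absolute value one. -/
theorem notMem_Phi_of_three_abs_eq_one {N : ℕ} {x : Fin N → ℝ} {p q r : Fin N}
    (hpq : p ≠ q) (hpr : p ≠ r) (hqr : q ≠ r)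
    (hp : |x p| = 1) (hq : |x q| = 1) (hr : |x r| = 1) : x ∉ Phi := by
  rintro (⟨i, j, -, s, t, -, -, rfl⟩ | ⟨ε, hε, -, rfl⟩)
  · have key : ∀ u : Fin N, |(s • kvec i + t • kvec j : Fin N → ℝ) u| = 1 → u = i ∨ u = j := by
      intro u hu
      by_contra! h
      simp [kvec, h.1, h.2] at hu
    rcases key p hp with rfl | rfl <;> rcases key q hq with rfl | rfl <;>
      rcases key r hr with rfl | rfl <;> simp_all
  · rcases hε p with h | h <;> simp only [h] at hp <;> norm_num [abs_eq] at hp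

/-- An extended root in the tip is `k_a ± k_j` with `j ∉ {a, b, c}`, or `-k_b - k_c`, or spinorial. -/
theorem tip_cases {N : ℕ} {x : Fin N → ℝ} (hx : x ∈ Phi) {a b c : Fin N}
    (hab : a ≠ b) (hac : a ≠ c) (hbc : b ≠ c)
    (h1 : x a - x b = 1) (h2 : x a + x b - 2 * x c = 1) :
    (∃ j t, j ≠ a ∧ j ≠ b ∧ j ≠ c ∧ (t = 1 ∨ t = -1) ∧ x = kvec a + (t : ℝ) • kvec j) ∨
      x = -kvec b - kvec c ∨ ∀ i, |2 * x i| = 1 := by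
  rcases hx with ⟨i, j, hij, s, t, hs, ht, rfl⟩ | ⟨ε, hε, -, rfl⟩
  · have hne := hij.ne
    have hne' := hij.ne'
    simp only [kvec, Pi.add_apply, Pi.smul_apply, smul_eq_mul] at h1 h2
    by_cases hia : a = i
    · subst hia
      have hjb : b ≠ j := by
        rintro rfl
        rcases hs with rfl | rfl <;> rcases ht with rfl | rfl <;>
          simp [hab, hab.symm, hac.symm, hbc.symm] at h1 h2
      have hjc : c ≠ j := by
        rintro rfl
        rcases hs with rfl | rfl <;> rcases ht with rfl | rfl <;>
          simp [hab.symm, hac, hac.symm, hbc] at h1 h2 <;> linarith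
      have : s = 1 := by simpa [hne, hab.symm, hjb] using h1
      exact .inl ⟨j, t, hne', hjb.symm, hjc.symm, ht, by rw [this, one_smul]⟩
    by_cases hja : a = j
    · subst hja
      have hib : b ≠ i := by
        rintro rfl
        rcases hs with rfl | rfl <;> rcases ht with rfl | rfl <;>
          simp [hab, hab.symm, hac.symm, hbc.symm] at h1 h2
      have hic : c ≠ i := by
        rintro rfl
        rcases hs with rfl | rfl <;> rcases ht with rfl | rfl <;>
          simp [hab.symm, hac, hac.symm, hbc] at h1 h2 <;> linarith
      have : t = 1 := by simpa [hne', hab.symm, hib] using h1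
      exact .inl ⟨i, s, hne, hib.symm, hic.symm, hs, by rw [this, one_smul, add_comm]⟩
    refine .inr (.inl ?_)
    simp only [if_neg hia, if_neg hja] at h1 h2
    by_cases hib : b = i
    · subst hib
      by_cases hjc : c = j
      · subst hjc
        simp [hbc, hbc.symm] at h1 h2
        rw [show s = -1 by linarith, show t = -1 by linarith]
        simp [sub_eq_add_neg]
      · simp [hne, hbc.symm, hjc] at h1 h2
        linarith
    · by_cases hjb : b = j
      · subst hjb
        by_cases hic : c = i
        · subst hic
          simp [hbc, hbc.symm] at h1 h2
          rw [show s = -1 by linarith, show t = -1 by linarith]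
          simp [sub_eq_add_neg, add_comm]
        · simp [hne', hbc.symm, hic] at h1 h2
          linarith
      · simp [hib, hjb] at h1
  · refine .inr (.inr fun i => ?_)
    rcases hε i with h | h <;> simp only [h] <;> norm_num

/-- For `x` in the tip other than `k_a ± k_l` and `-k_b - k_c`, the vectors `2x - (k_a ± k_l)` and
`2x + (k_b + k_c)` are not extended roots. -/
theorem two_smul_tip_notMem_Phi {N : ℕ} {x : Fin N → ℝ} (hx : x ∈ Phi) {a b c d e l : Fin N}
    (hab : a ≠ b) (hac : a ≠ c) (hbc : b ≠ c) (hda : d ≠ a) (hdb : d ≠ b) (hdc : d ≠ c)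
    (hea : e ≠ a) (heb : e ≠ b) (hec : e ≠ c) (hed : e ≠ d)
    (hlb : b ≠ l) (hlc : c ≠ l) (hld : d ≠ l)
    (h1 : x a - x b = 1) (h2 : x a + x b - 2 * x c = 1)
    (hne1 : x ≠ kvec a + kvec l) (hne2 : x ≠ kvec a - kvec l) (hne3 : x ≠ -kvec b - kvec c) :
    (2 : ℝ) • x - (kvec a + kvec l) ∉ (Phi : Set (Fin N → ℝ)) ∧
      (2 : ℝ) • x - (kvec a - kvec l) ∉ (Phi : Set (Fin N → ℝ)) ∧
      (2 : ℝ) • x + (kvec b + kvec c) ∉ (Phi : Set (Fin N → ℝ)) := by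
  rcases tip_cases hx hab hac hbc h1 h2 with ⟨j, t, hja, hjb, hjc, ht, rfl⟩ | h | h
  · have hjl : j ≠ l := by
      rintro rfl
      rcases ht with rfl | rfl
      · exact hne1 (by rw [one_smul])
      · exact hne2 (by rw [neg_one_smul, sub_eq_add_neg])
    refine ⟨fun h => ?_, fun h => ?_, fun h => ?_⟩ <;>
    · have := abs_le_one_of_mem_Phi h j
      rcases ht with rfl | rfl <;> norm_num [kvec, hja, hjb, hjc, hjl] at this
  · exact absurd h hne3
  · refine ⟨notMem_Phi_of_three_abs_eq_one hbc hdb.symm hdc.symm ?_ ?_ ?_,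
      notMem_Phi_of_three_abs_eq_one hbc hdb.symm hdc.symm ?_ ?_ ?_,
      notMem_Phi_of_three_abs_eq_one hda.symm hea.symm hed.symm ?_ ?_ ?_⟩
    · simpa [kvec, hab.symm, hlb] using h b
    · simpa [kvec, hac.symm, hlc] using h c
    · simpa [kvec, hda, hld] using h d
    · simpa [kvec, hab.symm, hlb] using h b
    · simpa [kvec, hac.symm, hlc] using h c
    · simpa [kvec, hda, hld] using h d
    · simpa [kvec, hab, hac] using h a
    · simpa [kvec, hdb, hdc] using h d
    · simpa [kvec, heb, hec] using h e

/-- For α ∈ T_{(1,1)} different from ρ_1 = k_1 + k_N, ρ_2 = k_1 - k_N and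
ρ_3 = -k_2 - k_3, none of 2α - ρ_1, 2α - ρ_2, 2α + (k_2 + k_3) lies in Φ. -/
theorem stmt19 (n : ℕ) (hn : 1 ≤ n) (α : Fin (4*(n+1)) → ℝ)
    (hα : α ∈ (Phi : Set (Fin (4*(n+1)) → ℝ)))
    (h1 : inn α (kvec ⟨0, by omega⟩ - kvec ⟨1, by omega⟩) = 1)
    (h2 : inn α (kvec ⟨0, by omega⟩ + kvec ⟨1, by omega⟩ - (2:ℝ) • kvec ⟨2, by omega⟩) = 1)
    (hne1 : α ≠ kvec ⟨0, by omega⟩ + kvec ⟨4*(n+1)-1, by omega⟩)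
    (hne2 : α ≠ kvec ⟨0, by omega⟩ - kvec ⟨4*(n+1)-1, by omega⟩)
    (hne3 : α ≠ -(kvec ⟨1, by omega⟩) - kvec ⟨2, by omega⟩) :
    (2:ℝ) • α - (kvec ⟨0, by omega⟩ + kvec ⟨4*(n+1)-1, by omega⟩) ∉ (Phi : Set (Fin (4*(n+1)) → ℝ)) ∧
    (2:ℝ) • α - (kvec ⟨0, by omega⟩ - kvec ⟨4*(n+1)-1, by omega⟩) ∉ (Phi : Set (Fin (4*(n+1)) → ℝ)) ∧
    (2:ℝ) • α + (kvec ⟨1, by omega⟩ + kvec ⟨2, by omega⟩) ∉ (Phi : Set (Fin (4*(n+1)) → ℝ)) := by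
  simp only [inn_add, inn_sub, inn_smul, inn_kvec] at h1 h2
  refine two_smul_tip_notMem_Phi (d := ⟨3, by omega⟩) (e := ⟨4, by omega⟩) hα
    ?_ ?_ ?_ ?_ ?_ ?_ ?_ ?_ ?_ ?_ ?_ ?_ ?_ h1 h2 hne1 hne2 hne3 <;>
  · simp only [ne_eq, Fin.mk.injEq]
    omega
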